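/- Let μ_n, μ be probability measures on ℝ. Then μ_n converges weakly to μ if and only if the F-transforms F_{μ_n} converge to F_μ locally uniformly on the upper half-plane ℍ. -/

import Mathlib

open MeasureTheory Complex Filter

open scoped BoundedContinuousFunction Topology

lemma sub_ofReal_ne_zero {z : ℂ} (hz : z.im ≠ 0) (x : ℝ) : z - x ≠ 0 := by
  intro h
  exact hz (by simpa using congrArg Complex.im h)

lemma norm_inv_sub_ofReal_le {z : ℂ} (hz : z.im ≠ 0) (x : ℝ) :
    ‖(z - x)⁻¹‖ ≤ |z.im|⁻¹ := by
  rw [norm_inv]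
  have h : |z.im| ≤ ‖z - x‖ := by simpa using Complex.abs_im_le_norm (z - x)
  exact inv_anti₀ (abs_pos.2 hz) h

lemma inv_sub_ofReal_sub_inv_sub_ofReal {z w : ℂ} (hz : z.im ≠ 0) (hw : w.im ≠ 0) (x : ℝ) :
    (z - x)⁻¹ - (w - x)⁻¹ = (w - z) * ((z - x)⁻¹ * (w - x)⁻¹) := by
  have hz' := sub_ofReal_ne_zero hz x
  have hw' := sub_ofReal_ne_zero hw x
  field_simp
  ring

/-- The Cauchy kernel `x ↦ 1 / (z - x)` as a bounded continuous function on `ℝ`. -/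
noncomputable def cauchyKernel (z : {z : ℂ // z.im ≠ 0}) : ℝ →ᵇ ℂ :=
  BoundedContinuousFunction.ofNormedAddCommGroup (fun x : ℝ => ((z : ℂ) - x)⁻¹)
    (Continuous.inv₀ (by fun_prop) (sub_ofReal_ne_zero z.2)) |(z : ℂ).im|⁻¹
    (norm_inv_sub_ofReal_le z.2)

@[simp]
lemma cauchyKernel_apply (z : {z : ℂ // z.im ≠ 0}) (x : ℝ) :
    cauchyKernel z x = ((z : ℂ) - x)⁻¹ := rfl

lemma norm_cauchyKernel_le (z : {z : ℂ // z.im ≠ 0}) : ‖cauchyKernel z‖ ≤ |(z : ℂ).im|⁻¹ :=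
  BoundedContinuousFunction.norm_ofNormedAddCommGroup_le _ (by positivity) _

lemma cauchyKernel_sub (z w : {z : ℂ // z.im ≠ 0}) :
    cauchyKernel z - cauchyKernel w
      = ((w : ℂ) - z) • (cauchyKernel z * cauchyKernel w) := by
  ext x
  simpa using inv_sub_ofReal_sub_inv_sub_ofReal z.2 w.2 x

lemma star_cauchyKernel (z : {z : ℂ // z.im ≠ 0}) :
    star (cauchyKernel z) = cauchyKernel ⟨star (z : ℂ), by simpa using z.2⟩ := by
  ext x
  simp

lemma tendsto_cauchyKernel_add_ofReal (z : {z : ℂ // z.im ≠ 0}) :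
    Tendsto (fun t : ℝ => cauchyKernel ⟨(z : ℂ) + t, by simpa using z.2⟩) (𝓝 0)
      (𝓝 (cauchyKernel z)) := by
  rw [tendsto_iff_norm_sub_tendsto_zero]
  have hlim : Tendsto (fun t : ℝ => |t| * (|(z : ℂ).im|⁻¹ * |(z : ℂ).im|⁻¹)) (𝓝 0) (𝓝 0) := by
    have : Continuous fun t : ℝ => |t| * (|(z : ℂ).im|⁻¹ * |(z : ℂ).im|⁻¹) := by fun_prop
    simpa using this.tendsto 0
  refine squeeze_zero (fun _ => norm_nonneg _) (fun t => ?_) hlim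
  rw [cauchyKernel_sub, norm_smul]
  have h1 := norm_cauchyKernel_le ⟨(z : ℂ) + t, by simpa using z.2⟩
  have h2 := norm_cauchyKernel_le z
  simp only [add_im, ofReal_im, add_zero] at h1
  refine mul_le_mul (by simp) ((norm_mul_le _ _).trans ?_) (norm_nonneg _) (abs_nonneg _)
  gcongr

/-- The closed linear span of the constants and the Cauchy kernels. -/
noncomputable def cauchySpan : Submodule ℂ (ℝ →ᵇ ℂ) :=
  (Submodule.span ℂ (insert 1 (Set.range cauchyKernel))).topologicalClosure

lemma isClosed_cauchySpan : IsClosed (cauchySpan : Set (ℝ →ᵇ ℂ)) :=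
  Submodule.isClosed_topologicalClosure _

lemma one_mem_cauchySpan : (1 : ℝ →ᵇ ℂ) ∈ cauchySpan :=
  Submodule.le_topologicalClosure _ (Submodule.subset_span (Set.mem_insert _ _))

lemma cauchyKernel_mem_cauchySpan (z : {z : ℂ // z.im ≠ 0}) : cauchyKernel z ∈ cauchySpan :=
  Submodule.le_topologicalClosure _
    (Submodule.subset_span (Set.mem_insert_of_mem _ (Set.mem_range_self z)))

lemma cauchySpan_le {T : Submodule ℂ (ℝ →ᵇ ℂ)} (hT : IsClosed (T : Set (ℝ →ᵇ ℂ)))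
    (h1 : 1 ∈ T) (hk : ∀ z, cauchyKernel z ∈ T) : cauchySpan ≤ T := by
  refine Submodule.topologicalClosure_minimal _ (Submodule.span_le.2 ?_) hT
  rintro _ (rfl | ⟨z, rfl⟩)
  exacts [h1, hk z]

lemma cauchyKernel_mul_cauchyKernel_mem_of_ne {z w : {z : ℂ // z.im ≠ 0}} (h : z ≠ w) :
    cauchyKernel z * cauchyKernel w ∈ cauchySpan := by
  have hne : (w : ℂ) - z ≠ 0 := sub_ne_zero.2 fun h' => h (Subtype.ext h'.symm)
  have : cauchyKernel z * cauchyKernel w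
      = ((w : ℂ) - z)⁻¹ • (cauchyKernel z - cauchyKernel w) := by
    rw [cauchyKernel_sub, smul_smul, inv_mul_cancel₀ hne, one_smul]
  rw [this]
  exact cauchySpan.smul_mem _
    (cauchySpan.sub_mem (cauchyKernel_mem_cauchySpan z) (cauchyKernel_mem_cauchySpan w))

lemma cauchyKernel_mul_cauchyKernel_mem (z w : {z : ℂ // z.im ≠ 0}) :
    cauchyKernel z * cauchyKernel w ∈ cauchySpan := by
  by_cases h : z = w
  · subst h
    have hlim := ((tendsto_cauchyKernel_add_ofReal z).const_mul (cauchyKernel z)).mono_left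
      (nhdsWithin_le_nhds (s := {0}ᶜ))
    refine isClosed_cauchySpan.mem_of_tendsto hlim ?_
    filter_upwards [self_mem_nhdsWithin] with t ht
    refine cauchyKernel_mul_cauchyKernel_mem_of_ne fun h => ht ?_
    simpa using congrArg Subtype.val h
  · exact cauchyKernel_mul_cauchyKernel_mem_of_ne h

lemma mul_mem_cauchySpan {f g : ℝ →ᵇ ℂ} (hf : f ∈ cauchySpan) (hg : g ∈ cauchySpan) :
    f * g ∈ cauchySpan := by
  have closed_comap (h : ℝ →ᵇ ℂ) :
      IsClosed (cauchySpan.comap (LinearMap.mulLeft ℂ h) : Set (ℝ →ᵇ ℂ)) :=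
    isClosed_cauchySpan.preimage (continuous_const_mul h)
  have kernel_mul (z : {z : ℂ // z.im ≠ 0}) {h : ℝ →ᵇ ℂ} (hh : h ∈ cauchySpan) :
      cauchyKernel z * h ∈ cauchySpan :=
    cauchySpan_le (closed_comap (cauchyKernel z))
      (by simpa using cauchyKernel_mem_cauchySpan z)
      (fun w => cauchyKernel_mul_cauchyKernel_mem z w) hh
  rw [mul_comm]
  refine cauchySpan_le (closed_comap g) (by simpa using hg) (fun z => ?_) hf
  simpa [mul_comm] using kernel_mul z hg

lemma star_mem_cauchySpan {f : ℝ →ᵇ ℂ} (hf : f ∈ cauchySpan) : star f ∈ cauchySpan := by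
  have hle : cauchySpan ≤ cauchySpan.comap (starLinearEquiv ℂ (A := ℝ →ᵇ ℂ)).toLinearMap := by
    refine cauchySpan_le (isClosed_cauchySpan.preimage continuous_star) ?_ fun z => ?_
    · simpa using one_mem_cauchySpan
    · simpa [star_cauchyKernel] using cauchyKernel_mem_cauchySpan _
  exact hle hf

/-- The star subalgebra of bounded continuous functions carried by `cauchySpan`. -/
noncomputable def cauchyStarSubalgebra : StarSubalgebra ℂ (ℝ →ᵇ ℂ) where
  carrier := cauchySpan
  mul_mem' := mul_mem_cauchySpan
  add_mem' := cauchySpan.add_mem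
  algebraMap_mem' c := by
    rw [Algebra.algebraMap_eq_smul_one]
    exact cauchySpan.smul_mem c one_mem_cauchySpan
  star_mem' := star_mem_cauchySpan

lemma separatesPoints_cauchyStarSubalgebra :
    (cauchyStarSubalgebra.map
      (BoundedContinuousFunction.toContinuousMapStarₐ ℂ)).SeparatesPoints := by
  intro x y hxy
  let z : {z : ℂ // z.im ≠ 0} := ⟨I, by simp⟩
  refine ⟨cauchyKernel z, ⟨_, ⟨cauchyKernel z, cauchyKernel_mem_cauchySpan z, rfl⟩, rfl⟩, ?_⟩
  intro h
  apply hxy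
  simpa [z] using h

lemma isClosed_setOf_tendsto_integral {ι : Type*} {l : Filter ι} {E : Type*}
    [TopologicalSpace E] [MeasurableSpace E] [OpensMeasurableSpace E]
    (μ : ι → Measure E) (ν : Measure E) [∀ i, IsProbabilityMeasure (μ i)]
    [IsProbabilityMeasure ν] :
    IsClosed {g : E →ᵇ ℂ | Tendsto (fun i => ∫ x, g x ∂(μ i)) l (𝓝 (∫ x, g x ∂ν))} := by
  have key (ρ : Measure E) [IsProbabilityMeasure ρ] (f g : E →ᵇ ℂ) :
      dist (∫ x, f x ∂ρ) (∫ x, g x ∂ρ) ≤ dist f g := by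
    rw [dist_eq_norm, dist_eq_norm, ← integral_sub (f.integrable ρ) (g.integrable ρ)]
    simpa using (f - g).norm_integral_le_norm ρ
  refine isClosed_of_closure_subset fun g hg => Metric.tendsto_nhds.2 fun ε hε => ?_
  obtain ⟨f, hf, hfg⟩ := Metric.mem_closure_iff.1 hg (ε / 3) (by positivity)
  filter_upwards [Metric.tendsto_nhds.1 hf (ε / 3) (by positivity)] with i hi
  have h1 := key (μ i) g f
  have h2 := key ν f g
  have h3 := dist_triangle4 (∫ x, g x ∂(μ i)) (∫ x, f x ∂(μ i)) (∫ x, f x ∂ν) (∫ x, g x ∂ν)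
  rw [dist_comm f g] at h2
  linarith

/-- Convergence of the Cauchy transforms off the real line gives convergence of the integrals of
every element of `cauchySpan`. -/
lemma tendsto_integral_of_mem_cauchySpan {ι : Type*} {l : Filter ι} (μ : ι → Measure ℝ)
    (ν : Measure ℝ) [∀ i, IsProbabilityMeasure (μ i)] [IsProbabilityMeasure ν]
    (h : ∀ z, Tendsto (fun i => ∫ x, cauchyKernel z x ∂(μ i)) l (𝓝 (∫ x, cauchyKernel z x ∂ν)))
    {g : ℝ →ᵇ ℂ} (hg : g ∈ cauchySpan) :
    Tendsto (fun i => ∫ x, g x ∂(μ i)) l (𝓝 (∫ x, g x ∂ν)) := by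
  let T : Submodule ℂ (ℝ →ᵇ ℂ) :=
    { carrier := {g | Tendsto (fun i => ∫ x, g x ∂(μ i)) l (𝓝 (∫ x, g x ∂ν))}
      zero_mem' := by simpa using tendsto_const_nhds
      add_mem' := by
        intro f g hf hg
        have key (ρ : Measure ℝ) [IsProbabilityMeasure ρ] :
            ∫ x, (f + g) x ∂ρ = ∫ x, f x ∂ρ + ∫ x, g x ∂ρ :=
          integral_add (f.integrable ρ) (g.integrable ρ)
        simp only [Set.mem_ofPred_eq, key] at *
        exact hf.add hg
      smul_mem' := by
        intro c f hf
        simp only [Set.mem_ofPred_eq, BoundedContinuousFunction.coe_smul, integral_smul] at *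
        exact hf.const_smul c }
  exact cauchySpan_le (T := T) (isClosed_setOf_tendsto_integral μ ν) (by simpa [T] using tendsto_const_nhds) h hg

lemma integrable_inv_sub_ofReal (ρ : Measure ℝ) [IsFiniteMeasure ρ] {z : ℂ} (hz : z.im ≠ 0) :
    Integrable (fun x : ℝ => (z - x)⁻¹) ρ :=
  (cauchyKernel ⟨z, hz⟩).integrable ρ

lemma integral_inv_sub_ofReal_ne_zero (ρ : Measure ℝ) [IsProbabilityMeasure ρ] {z : ℂ}
    (hz : 0 < z.im) : ∫ x : ℝ, (z - x)⁻¹ ∂ρ ≠ 0 := by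
  have hint := integrable_inv_sub_ofReal ρ hz.ne'
  have hpos : 0 < ∫ x : ℝ, -((z - x)⁻¹).im ∂ρ := by
    have hx (x : ℝ) : 0 < -((z - x)⁻¹).im := by
      have := Complex.normSq_pos.2 (sub_ofReal_ne_zero hz.ne' x)
      simp only [inv_im, sub_im, ofReal_im, sub_zero, neg_div, neg_neg]
      positivity
    rw [integral_pos_iff_support_of_nonneg (fun x => (hx x).le) hint.im.neg]
    have : Function.support (fun x : ℝ => -((z - x)⁻¹).im) = Set.univ :=
      Set.eq_univ_of_forall fun x => (hx x).ne'
    rw [this]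
    simp
  intro h
  have him : ∫ x : ℝ, ((z - x)⁻¹).im ∂ρ = (∫ x : ℝ, (z - x)⁻¹ ∂ρ).im := integral_im hint
  rw [integral_neg, him, h] at hpos
  simp at hpos

lemma norm_integral_inv_sub_ofReal_sub_le (ρ : Measure ℝ) [IsProbabilityMeasure ρ] {z w : ℂ}
    {c : ℝ} (hc : 0 < c) (hz : c ≤ z.im) (hw : c ≤ w.im) :
    ‖∫ x : ℝ, (z - x)⁻¹ ∂ρ - ∫ x : ℝ, (w - x)⁻¹ ∂ρ‖ ≤ ‖w - z‖ * (c⁻¹ * c⁻¹) := by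
  have hz' : z.im ≠ 0 := (hc.trans_le hz).ne'
  have hw' : w.im ≠ 0 := (hc.trans_le hw).ne'
  have kernel_le {u : ℂ} (hu : c ≤ u.im) (x : ℝ) : ‖(u - x)⁻¹‖ ≤ c⁻¹ :=
    (norm_inv_sub_ofReal_le (hc.trans_le hu).ne' x).trans
      (inv_anti₀ hc (hu.trans (le_abs_self _)))
  rw [← integral_sub (integrable_inv_sub_ofReal ρ hz') (integrable_inv_sub_ofReal ρ hw')]
  refine (norm_integral_le_of_norm_le_const (C := ‖w - z‖ * (c⁻¹ * c⁻¹))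
    (ae_of_all _ fun x => ?_)).trans (by simp)
  rw [inv_sub_ofReal_sub_inv_sub_ofReal hz' hw', norm_mul, norm_mul]
  have := kernel_le hz x
  have := kernel_le hw x
  gcongr

lemma continuousOn_integral_inv_sub_ofReal (ρ : Measure ℝ) [IsProbabilityMeasure ρ] :
    ContinuousOn (fun z : ℂ => ∫ x : ℝ, (z - x)⁻¹ ∂ρ) {z : ℂ | 0 < z.im} := by
  intro z hz
  refine ContinuousAt.continuousWithinAt (tendsto_iff_norm_sub_tendsto_zero.2 ?_)
  have hc : 0 < z.im / 2 := half_pos hz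
  have hlim : Tendsto (fun w : ℂ => ‖z - w‖ * ((z.im / 2)⁻¹ * (z.im / 2)⁻¹)) (𝓝 z) (𝓝 0) := by
    have : Continuous fun w : ℂ => ‖z - w‖ * ((z.im / 2)⁻¹ * (z.im / 2)⁻¹) := by fun_prop
    simpa using this.tendsto z
  refine squeeze_zero' (Eventually.of_forall fun _ => norm_nonneg _) ?_ hlim
  filter_upwards [(continuous_im.tendsto z).eventually_const_lt (half_lt_self hz)] with w hw
  exact norm_integral_inv_sub_ofReal_sub_le ρ hc hw.le (half_lt_self hz).le

/-- Pointwise convergence of Cauchy transforms on the upper half-plane is automatically locally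
uniform. -/
lemma tendstoLocallyUniformlyOn_integral_inv_sub_ofReal {ι : Type*} {l : Filter ι}
    (μ : ι → Measure ℝ) (ν : Measure ℝ) [∀ i, IsProbabilityMeasure (μ i)]
    [IsProbabilityMeasure ν]
    (h : ∀ z : ℂ, 0 < z.im →
      Tendsto (fun i => ∫ x : ℝ, (z - x)⁻¹ ∂(μ i)) l (𝓝 (∫ x : ℝ, (z - x)⁻¹ ∂ν))) :
    TendstoLocallyUniformlyOn (fun i (z : ℂ) => ∫ x : ℝ, (z - x)⁻¹ ∂(μ i))
      (fun z : ℂ => ∫ x : ℝ, (z - x)⁻¹ ∂ν) l {z : ℂ | 0 < z.im} := by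
  rw [Metric.tendstoLocallyUniformlyOn_iff]
  intro ε hε z hz
  set c := z.im / 2
  have hc0 : 0 < c := half_pos hz
  have hcz : c < z.im := half_lt_self hz
  have hnear : ∀ᶠ w in 𝓝 z, c < w.im ∧ ‖w - z‖ * (c⁻¹ * c⁻¹) < ε / 3 := by
    have h1 : Continuous fun w : ℂ => ‖w - z‖ * (c⁻¹ * c⁻¹) := by fun_prop
    exact (continuous_im.tendsto z |>.eventually_const_lt hcz).and
      ((h1.tendsto z).eventually_lt_const (by simpa using hε))
  refine ⟨_, nhdsWithin_le_nhds hnear, ?_⟩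
  filter_upwards [Metric.tendsto_nhds.1 (h z hz) (ε / 3) (by positivity)] with i hi w hw
  have h1 := norm_integral_inv_sub_ofReal_sub_le (μ i) hc0 hcz.le hw.1.le
  have h2 := norm_integral_inv_sub_ofReal_sub_le ν hc0 hcz.le hw.1.le
  rw [← dist_eq_norm] at h1 h2
  have h3 := dist_triangle4 (∫ x : ℝ, (w - x)⁻¹ ∂ν) (∫ x : ℝ, (z - x)⁻¹ ∂ν)
    (∫ x : ℝ, (z - x)⁻¹ ∂(μ i)) (∫ x : ℝ, (w - x)⁻¹ ∂(μ i))
  rw [dist_comm] at h2 hi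
  have := hw.2
  linarith

/-- A tail bound for a probability measure in terms of its Cauchy transform on the imaginary
axis. -/
lemma measure_norm_gt_le (ρ : Measure ℝ) [IsProbabilityMeasure ρ] {r : ℝ} (hr : 0 < r) :
    ρ {x | r < ‖x‖}
      ≤ ENNReal.ofReal (2 * (1 - (r * I) * ∫ x : ℝ, (r * I - x)⁻¹ ∂ρ).re) := by
  have him : ((r : ℂ) * I).im ≠ 0 := by simpa using hr.ne'
  have hint : Integrable (fun x : ℝ => 1 - (r * I) * (r * I - x)⁻¹) ρ :=
    (integrable_const _).sub ((integrable_inv_sub_ofReal ρ him).const_mul _)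
  have hre (x : ℝ) : (1 - (r * I) * (r * I - x)⁻¹).re = x ^ 2 / (r ^ 2 + x ^ 2) := by
    have : r ^ 2 + x ^ 2 ≠ 0 := by positivity
    simp [Complex.normSq_apply, ← sq]
    field_simp
    ring
  have hintre : Integrable (fun x : ℝ => x ^ 2 / (r ^ 2 + x ^ 2)) ρ := by
    simp_rw [← hre]
    exact hint.re
  have heq : (1 - (r * I) * ∫ x : ℝ, (r * I - x)⁻¹ ∂ρ).re = ∫ x, x ^ 2 / (r ^ 2 + x ^ 2) ∂ρ := by
    have h1 : ∫ x : ℝ, (1 - (r * I) * (r * I - x)⁻¹ : ℂ) ∂ρ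
        = 1 - (r * I) * ∫ x : ℝ, (r * I - x)⁻¹ ∂ρ := by
      rw [integral_sub (integrable_const _) ((integrable_inv_sub_ofReal ρ him).const_mul _),
        integral_const_mul]
      simp
    rw [← h1]
    simp_rw [← hre]
    exact (integral_re hint).symm
  have hmarkov := mul_meas_ge_le_integral_of_nonneg
    (ae_of_all ρ fun x : ℝ => (by positivity : 0 ≤ x ^ 2 / (r ^ 2 + x ^ 2))) hintre (1 / 2)
  rw [heq]
  calc ρ {x | r < ‖x‖} ≤ ρ {x | 1 / 2 ≤ x ^ 2 / (r ^ 2 + x ^ 2)} := by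
        refine measure_mono fun x hx => ?_
        have hx' : r ^ 2 < x ^ 2 := by
          rw [← sq_abs x]
          exact pow_lt_pow_left₀ hx hr.le two_ne_zero
        simp only [Set.mem_ofPred_eq]
        rw [div_le_div_iff₀ two_pos (by positivity)]
        linarith
    _ ≤ _ := by
        rw [← ofReal_measureReal]
        exact ENNReal.ofReal_le_ofReal (by linarith)

lemma tendsto_mul_integral_inv_sub_ofReal (ρ : Measure ℝ) [IsProbabilityMeasure ρ] :
    Tendsto (fun r : ℝ => (r * I) * ∫ x : ℝ, (r * I - x)⁻¹ ∂ρ) atTop (𝓝 1) := by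
  have h1 : ∫ _ : ℝ, (1 : ℂ) ∂ρ = 1 := by simp
  simp_rw [← integral_const_mul]
  rw [← h1]
  refine tendsto_integral_filter_of_dominated_convergence (fun _ => 1) ?_ ?_
    (integrable_const _) ?_
  · filter_upwards [eventually_gt_atTop 0] with r hr
    exact ((integrable_inv_sub_ofReal ρ (by simpa using hr.ne')).const_mul _).aestronglyMeasurable
  · filter_upwards [eventually_gt_atTop 0] with r hr
    refine ae_of_all _ fun x => ?_
    have h := norm_inv_sub_ofReal_le (z := r * I) (by simpa using hr.ne') x
    have hnorm : ‖(r : ℂ) * I‖ = |r| := by simp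
    rw [norm_mul, hnorm]
    calc |r| * ‖((r : ℂ) * I - x)⁻¹‖ ≤ |r| * |r|⁻¹ := by
          gcongr
          simpa using h
      _ = 1 := mul_inv_cancel₀ (abs_ne_zero.2 hr.ne')
  · refine ae_of_all _ fun x => ?_
    have hlim : Tendsto (fun r : ℝ => (1 - (x / I) * ((r⁻¹ : ℝ) : ℂ))⁻¹) atTop (𝓝 1) := by
      have h0 : Tendsto (fun r : ℝ => ((r⁻¹ : ℝ) : ℂ)) atTop (𝓝 0) := by
        exact (continuous_ofReal.tendsto' 0 0 ofReal_zero).comp tendsto_inv_atTop_zero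
      simpa using ((h0.const_mul (x / I)).const_sub 1).inv₀ (by simp)
    refine hlim.congr' ?_
    filter_upwards [eventually_gt_atTop 0] with r hr
    have hr' : (r : ℂ) ≠ 0 := by exact_mod_cast hr.ne'
    have hne := sub_ofReal_ne_zero (z := r * I) (by simpa using hr.ne') x
    rw [inv_eq_iff_eq_inv, mul_inv, inv_inv]
    push_cast
    field_simp

lemma isTightMeasureSet_range_of_tendsto_cauchyTransform (μ : ℕ → Measure ℝ) (ν : Measure ℝ)
    [∀ n, IsProbabilityMeasure (μ n)] [IsProbabilityMeasure ν]
    (h : ∀ z : ℂ, 0 < z.im →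
      Tendsto (fun n => ∫ x : ℝ, (z - x)⁻¹ ∂(μ n)) atTop (𝓝 (∫ x : ℝ, (z - x)⁻¹ ∂ν))) :
    IsTightMeasureSet (Set.range μ) := by
  refine isTightMeasureSet_range_of_tendsto_limsup_measure_norm_gt ?_
  have hlim : Tendsto (fun r : ℝ =>
      ENNReal.ofReal (2 * (1 - (r * I) * ∫ x : ℝ, (r * I - x)⁻¹ ∂ν).re)) atTop (𝓝 0) := by
    have h1 := (continuous_re.tendsto _).comp ((tendsto_mul_integral_inv_sub_ofReal ν).const_sub 1)
    simpa using! ENNReal.tendsto_ofReal (h1.const_mul 2)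
  refine tendsto_of_tendsto_of_tendsto_of_le_of_le' tendsto_const_nhds hlim
    (Eventually.of_forall fun _ => zero_le) ?_
  filter_upwards [eventually_gt_atTop 0] with r hr
  have hr' : 0 < ((r : ℂ) * I).im := by simpa using hr
  have hconv : Tendsto (fun n =>
      ENNReal.ofReal (2 * (1 - (r * I) * ∫ x : ℝ, (r * I - x)⁻¹ ∂(μ n)).re)) atTop
      (𝓝 (ENNReal.ofReal (2 * (1 - (r * I) * ∫ x : ℝ, (r * I - x)⁻¹ ∂ν).re))) :=
    ENNReal.tendsto_ofReal (((continuous_re.tendsto _).comp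
      (((h _ hr').const_mul _).const_sub 1)).const_mul 2)
  rw [← hconv.limsup_eq]
  exact limsup_le_limsup (Eventually.of_forall fun n => measure_norm_gt_le (μ n) hr)

lemma integral_inv_star_sub_ofReal (ρ : Measure ℝ) (z : ℂ) :
    ∫ x : ℝ, (star z - x)⁻¹ ∂ρ = star (∫ x : ℝ, (z - x)⁻¹ ∂ρ) := by
  have h := integral_conj (μ := ρ) (f := fun x : ℝ => (z - x)⁻¹)
  simpa using h

/-- Weak convergence of probability measures `μ_n → μ` on `ℝ` is equivalent to
locally uniform convergence on the upper half-plane of the F-transforms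
`F_{μ_n} → F_μ`, where `F_ν(z) = (∫ 1/(z-u) dν(u))⁻¹`. -/
theorem weak_convergence_iff_fTransform_locally_uniform
    (μ : ℕ → Measure ℝ) (ν : Measure ℝ)
    [∀ n, IsProbabilityMeasure (μ n)] [IsProbabilityMeasure ν] :
    (∀ f : BoundedContinuousFunction ℝ ℝ,
        Tendsto (fun n => ∫ x, f x ∂(μ n)) atTop (nhds (∫ x, f x ∂ν))) ↔
      TendstoLocallyUniformlyOn
        (fun n (z : ℂ) => (∫ x : ℝ, (z - x)⁻¹ ∂(μ n))⁻¹)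
        (fun z : ℂ => (∫ x : ℝ, (z - x)⁻¹ ∂ν)⁻¹)
        atTop {z : ℂ | 0 < z.im} := by
  let P (n : ℕ) : ProbabilityMeasure ℝ := ⟨μ n, inferInstance⟩
  let Q : ProbabilityMeasure ℝ := ⟨ν, inferInstance⟩
  have hweak : (∀ f : BoundedContinuousFunction ℝ ℝ,
      Tendsto (fun n => ∫ x, f x ∂(μ n)) atTop (𝓝 (∫ x, f x ∂ν))) ↔ Tendsto P atTop (𝓝 Q) :=
    (ProbabilityMeasure.tendsto_iff_forall_integral_tendsto (μs := P) (μ := Q)).symm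
  rw [hweak]
  constructor
  · intro h
    rw [ProbabilityMeasure.tendsto_iff_forall_integral_rclike_tendsto ℂ] at h
    have hG := tendstoLocallyUniformlyOn_integral_inv_sub_ofReal μ ν (l := atTop)
      fun z hz => h (cauchyKernel ⟨z, hz.ne'⟩)
    exact hG.inv₀ (continuousOn_integral_inv_sub_ofReal ν)
      fun z hz => integral_inv_sub_ofReal_ne_zero ν hz
  · intro h
    have hG (z : ℂ) (hz : 0 < z.im) :
        Tendsto (fun n => ∫ x : ℝ, (z - x)⁻¹ ∂(μ n)) atTop (𝓝 (∫ x : ℝ, (z - x)⁻¹ ∂ν)) := by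
      simpa using (h.tendsto_at hz).inv₀ (inv_ne_zero (integral_inv_sub_ofReal_ne_zero ν hz))
    have hG' (z : {z : ℂ // z.im ≠ 0}) : Tendsto (fun n => ∫ x, cauchyKernel z x ∂(μ n)) atTop
        (𝓝 (∫ x, cauchyKernel z x ∂ν)) := by
      rcases z.2.lt_or_gt with hz | hz
      · have hstar := (hG (star (z : ℂ)) (by simpa using hz)).star
        simpa only [integral_inv_star_sub_ofReal, star_star, cauchyKernel_apply] using hstar
      · exact hG z hz
    have htight : IsTightMeasureSet {(P n : Measure ℝ) | n} :=
      isTightMeasureSet_range_of_tendsto_cauchyTransform μ ν hG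
    exact ProbabilityMeasure.tendsto_of_tight_of_separatesPoints ℂ htight
      (A := cauchyStarSubalgebra) separatesPoints_cauchyStarSubalgebra
      fun g hg => tendsto_integral_of_mem_cauchySpan (fun n => (P n : Measure ℝ)) (Q : Measure ℝ)
        hG' hg
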